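/- There exist absolute constants c > 0 (c = 2^{−13}/100 suffices) and C such that the following holds. Let N be an odd positive integer, G = ℤ/Nℤ, let B be a regular Bohr set, and let A ⊆ B have relative density α > 0. Let B¹ be a regular Bohr set of rank d, let C₀ ⊆ B¹ have relative density γ > 0, and let σ ≥ μ(B)^{−1} be a parameter. Suppose ⟨μ_A∘μ_A, μ_{C₀}∘μ_{C₀}⟩ ≥ 2^{7}·σ. Then there are regular Bohr sets B', B'', where B' = B¹_ρ for some ρ ≥ (c/(2d))² and B'' ⊂_{c/d} B', a translate t ∈ G, and nonempty subsets A₁ ⊆ B', A₂ ⊆ B'' + t, each with relative density at least min(α^{C}·γ, α^{L(α)/log 2 + C}), such that ⟨μ_A∘μ_A, μ_{A₁}∘μ_{A₂}⟩ ≥ σ. -/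

import Mathlib

open Finset BigOperators Pointwise
open scoped Classical

namespace Formal

variable {G : Type*} [AddCommGroup G] [Fintype G]

/-- `ex f = 𝔼_{x ∈ G} f x`. -/
noncomputable def ex (f : G → ℝ) : ℝ := (∑ x, f x) / (Fintype.card G : ℝ)

/-- `ip f g = ⟨f, g⟩ = 𝔼_x f x * g x`. -/
noncomputable def ip (f g : G → ℝ) : ℝ := ex (fun x => f x * g x)

/-- `ipWt ν f g = ⟨f, g⟩_ν = 𝔼_x f x * g x * ν x`. -/
noncomputable def ipWt (ν f g : G → ℝ) : ℝ := ex (fun x => f x * g x * ν x)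

/-- Convolution `f ∗ g (x) = 𝔼_y f y * g (x - y)`. -/
noncomputable def cv (f g : G → ℝ) : G → ℝ := fun x => ex (fun y => f y * g (x - y))

/-- Difference convolution `f ∘ g (x) = 𝔼_y f y * g (x + y)`. -/
noncomputable def dcv (f g : G → ℝ) : G → ℝ := fun x => ex (fun y => f y * g (x + y))

/-- Normalized indicator measure `μ_A = (|G|/|A|) · 1_A`. -/
noncomputable def mu (A : Set G) : G → ℝ :=
  fun x => if x ∈ A then (Fintype.card G : ℝ) / (Nat.card A : ℝ) else 0

/-- Density `|A|/|G|`. -/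
noncomputable def density (A : Set G) : ℝ := (Nat.card A : ℝ) / (Fintype.card G : ℝ)

/-- Relative density `|A|/|B|`. -/
noncomputable def relDensity (A B : Set G) : ℝ := (Nat.card A : ℝ) / (Nat.card B : ℝ)

/-- `‖f‖_p = (𝔼_x |f x|^p)^{1/p}`. -/
noncomputable def lpNorm (p : ℝ) (f : G → ℝ) : ℝ := (ex (fun x => |f x| ^ p)) ^ (1 / p)

/-- `‖f‖_{p(ν)} = (𝔼_x |f x|^p ν x)^{1/p}`. -/
noncomputable def lpNormWt (p : ℝ) (ν f : G → ℝ) : ℝ := (ex (fun x => |f x| ^ p * ν x)) ^ (1 / p)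

/-- `‖f‖_∞ = max_x |f x|`. -/
noncomputable def linftyNorm (f : G → ℝ) : ℝ := ⨆ x, |f x|

/-- `‖f‖_1 = 𝔼_x |f x|`. -/
noncomputable def l1Norm (f : G → ℝ) : ℝ := ex (fun x => |f x|)

/-- Indicator function of a set. -/
noncomputable def indic (S : Set G) : G → ℝ := fun x => if x ∈ S then 1 else 0

/-- `Lq α = log (2/α)`. -/
noncomputable def Lq (α : ℝ) : ℝ := Real.log (2 / α)

/-- `iterConv f k` is the `k`-fold convolution `f ∗ ⋯ ∗ f` (for `k ≥ 1`);
`iterConv f 0` is the convolution identity. -/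
noncomputable def iterConv (f : G → ℝ) : ℕ → G → ℝ
  | 0 => fun x => if x = 0 then (Fintype.card G : ℝ) else 0
  | n + 1 => cv (iterConv f n) f

/-- Fourier transform `f̂ γ = 𝔼_x f x * conj (γ x)`. -/
noncomputable def ft (f : G → ℝ) (γ : AddChar G ℂ) : ℂ :=
  (∑ x, (f x : ℂ) * (starRingEnd ℂ) (γ x)) / (Fintype.card G : ℝ)

/-- The large spectrum `Δ_{1/2}(X)` of the measure `μ_X`. -/
noncomputable def Delta (X : Set G) : Set (AddChar G ℂ) :=
  {γ | 1 / 2 ≤ ‖ft (mu X) γ‖}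

/-- A Bohr set: a finite set of characters together with a radius. -/
structure Bohr (G : Type*) [AddCommGroup G] where
  freq : Finset (AddChar G ℂ)
  radius : ℝ

namespace Bohr

variable {G : Type*} [AddCommGroup G]

/-- The underlying set `{x : |1 - γ x| ≤ ρ for all γ ∈ Λ}` of a Bohr set. -/
def carrier (B : Bohr G) : Set G := {x | ∀ γ ∈ B.freq, ‖(1 : ℂ) - γ x‖ ≤ B.radius}

/-- The rank `|Λ|` of a Bohr set. -/
def rank (B : Bohr G) : ℕ := B.freq.card

/-- The dilate `B_δ` of a Bohr set. -/
def dilate (B : Bohr G) (δ : ℝ) : Bohr G := ⟨B.freq, δ * B.radius⟩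

/-- A Bohr set of rank `d` is regular if for all `|κ| ≤ 1/(100d)`,
`(1 - 100d|κ|)|B| ≤ |B_{1+κ}| ≤ (1 + 100d|κ|)|B|`. -/
def Regular (B : Bohr G) : Prop :=
  ∀ κ : ℝ, |κ| ≤ 1 / (100 * B.rank) →
    (1 - 100 * B.rank * |κ|) * (Nat.card B.carrier : ℝ) ≤
        (Nat.card ((B.dilate (1 + κ)).carrier) : ℝ) ∧
    (Nat.card ((B.dilate (1 + κ)).carrier) : ℝ) ≤
        (1 + 100 * B.rank * |κ|) * (Nat.card B.carrier : ℝ)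

/-- `B' ⊂_r B` : `B'` is a regular dilate `B_δ` of `B` with `δ ∈ [r/2, r]`. -/
def subR (r : ℝ) (B' B : Bohr G) : Prop :=
  ∃ δ : ℝ, r / 2 ≤ δ ∧ δ ≤ r ∧ B' = B.dilate δ ∧ B'.Regular

/-- The density `μ(B) = |B|/|G|` of a Bohr set. -/
noncomputable def dens (B : Bohr G) : ℝ := (Nat.card B.carrier : ℝ) / (Nat.card G : ℝ)

end Bohr


section MonotoneSlope

/-- A monotone function that is locally constant to the right and grows little on `[s', t']` has a
point in `[s, t]` around which its increments are bounded linearly (a rising sun argument). -/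
theorem exists_forall_abs_sub_le_mul {F : ℝ → ℝ} (hF : Monotone F)
    (hright : ∀ a, ∃ e > 0, F (a + e) = F a) {s' s t t' M : ℝ} (hs : s' ≤ s) (hst : s ≤ t)
    (ht : t ≤ t') (hM : 0 < M) (hgrowth : 2 * (F t' - F s') < M * (t - s)) :
    ∃ a ∈ Set.Icc s t, ∀ b ∈ Set.Icc s' t', |F b - F a| ≤ M * |b - a| := by
  by_contra! hbad
  let p : ℝ → ℝ := fun b => F b - M * b
  let g : ℝ → ℝ := fun a => sSup (p '' Set.Icc a t')
  let k : ℝ → ℝ := fun a => sInf (p '' Set.Icc s' a)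
  have hp_up : ∀ a b c, a ≤ b → b ≤ c → p b ≤ F c - M * a := fun a b c hab hbc =>
    sub_le_sub (hF hbc) (by gcongr)
  have hp_lo : ∀ a b c, a ≤ b → b ≤ c → F a - M * c ≤ p b := fun a b c hab hbc =>
    sub_le_sub (hF hab) (by gcongr)
  have hbg : ∀ a, BddAbove (p '' Set.Icc a t') := by
    rintro a
    refine ⟨F t' - M * a, ?_⟩
    rintro _ ⟨b, hb, rfl⟩
    exact hp_up _ _ _ hb.1 hb.2
  have hbk : ∀ a, BddBelow (p '' Set.Icc s' a) := by
    rintro a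
    refine ⟨F s' - M * a, ?_⟩
    rintro _ ⟨b, hb, rfl⟩
    exact hp_lo _ _ _ hb.1 hb.2
  have hpg : ∀ a b, a ≤ b → b ≤ t' → p b ≤ g a := fun a b hab hb =>
    le_csSup (hbg a) ⟨b, ⟨hab, hb⟩, rfl⟩
  have hkp : ∀ a b, s' ≤ b → b ≤ a → k a ≤ p b := fun a b hb hab =>
    csInf_le (hbk a) ⟨b, ⟨hb, hab⟩, rfl⟩
  have hg_le : ∀ a u, a ≤ t' → (∀ b, a ≤ b → b ≤ t' → p b ≤ u) → g a ≤ u := by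
    intro a u ha h
    refine csSup_le ⟨_, a, ⟨le_rfl, ha⟩, rfl⟩ ?_
    rintro _ ⟨b, hb, rfl⟩
    exact h b hb.1 hb.2
  have hle_k : ∀ a u, s' ≤ a → (∀ b, s' ≤ b → b ≤ a → u ≤ p b) → u ≤ k a := by
    intro a u ha h
    refine le_csInf ⟨_, a, ⟨ha, le_rfl⟩, rfl⟩ ?_
    rintro _ ⟨b, hb, rfl⟩
    exact h b hb.1 hb.2
  have hg_mono : ∀ a b, a ≤ b → b ≤ t' → g a + M * a ≤ g b + M * b := by
    intro a b hab hb
    rw [← le_sub_iff_add_le]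
    refine hg_le _ _ (hab.trans hb) fun x hax hxt => ?_
    have hMab : M * a ≤ M * b := by gcongr
    rcases le_total x b with hxb | hbx
    · have h1 := hp_up a x b hax hxb
      have h2 : F b - M * b ≤ g b := hpg b b le_rfl hb
      linarith
    · have := hpg b x hbx hxt
      linarith
  have hk_mono : ∀ a b, s' ≤ a → a ≤ b → k a + M * a ≤ k b + M * b := by
    intro a b ha hab
    rw [← sub_le_iff_le_add]
    refine hle_k _ _ (ha.trans hab) fun x hsx hxb => ?_
    have hMab : M * a ≤ M * b := by gcongr
    rcases le_total x a with hxa | hax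
    · have := hkp a x hsx hxa
      linarith
    · have h1 := hp_lo a x b hax hxb
      have h2 : k a ≤ F a - M * a := hkp a a ha le_rfl
      linarith
  let H : ℝ → ℝ := fun a => g a + k a + 2 * (M * a)
  have hH_mono : ∀ a b, s' ≤ a → a ≤ b → b ≤ t' → H a ≤ H b := by
    intro a b ha hab hb
    have h1 := hg_mono a b hab hb
    have h2 := hk_mono a b ha hab
    simp only [H]
    linarith
  have hstep : ∀ a, s ≤ a → a < t → ∃ b, a < b ∧ b ≤ t ∧ H a + M * (b - a) ≤ H b := by
    intro a hsa hat
    obtain ⟨e, he, hFe⟩ := hright a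
    have hconst : ∀ x, a ≤ x → x ≤ a + e → F x = F a := fun x h1 h2 =>
      le_antisymm ((hF h2).trans hFe.le) (hF h1)
    obtain ⟨b, ⟨hb1, hb2⟩, hb⟩ := hbad a ⟨hsa, hat.le⟩
    rcases le_total a b with hab | hba
    · rw [abs_of_nonneg (sub_nonneg.2 (hF hab)), abs_of_nonneg (sub_nonneg.2 hab)] at hb
      have hab' : a < b := by
        rcases hab.lt_or_eq with h | h
        · exact h
        · subst h; simp at hb
      refine ⟨min (min (a + e) b) t, by simp [he, hab', hat], min_le_right _ _, ?_⟩
      set c := min (min (a + e) b) t with hc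
      have hac : a ≤ c := by simp [hc, he.le, hab, hat.le]
      have hce : c ≤ a + e := (min_le_left _ _).trans (min_le_left _ _)
      have hcb : c ≤ b := (min_le_left _ _).trans (min_le_right _ _)
      have hct : c ≤ t' := (min_le_right _ _).trans ht
      have hg : g a ≤ g c := by
        refine hg_le _ _ (hat.le.trans ht) fun x hax hxt => ?_
        rcases le_total x c with hxc | hcx
        · have h1 : p b ≤ g c := hpg c b hcb hb2
          have h2 := hconst x hax (hxc.trans hce)
          have h3 : M * a ≤ M * x := by gcongr
          simp only [p] at h1 ⊢
          linarith
        · exact hpg c x hcx hxt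
      have h2 := hk_mono a c (hs.trans hsa) hac
      simp only [H]
      linarith
    · rw [abs_of_nonpos (sub_nonpos.2 (hF hba)), abs_of_nonpos (sub_nonpos.2 hba)] at hb
      have hgap : 0 < (F a - F b - M * (a - b)) / M := div_pos (by linarith) hM
      set h := (F a - F b - M * (a - b)) / M with hh
      have hMh : M * h = F a - F b - M * (a - b) := by rw [hh]; field_simp
      refine ⟨min (min (a + e) (a + h)) t, by simp [he, hgap, hat], min_le_right _ _, ?_⟩
      set c := min (min (a + e) (a + h)) t with hc
      have hac : a ≤ c := by simp [hc, he.le, hgap.le, hat.le]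
      have hce : c ≤ a + e := (min_le_left _ _).trans (min_le_left _ _)
      have hch : c ≤ a + h := (min_le_left _ _).trans (min_le_right _ _)
      have hct : c ≤ t' := (min_le_right _ _).trans ht
      have hk : k a ≤ k c := by
        refine hle_k _ _ ((hs.trans hsa).trans hac) fun x hsx hxc => ?_
        rcases le_total x a with hxa | hax
        · exact hkp a x hsx hxa
        · have h1 : k a ≤ p b := hkp a b hb1 hba
          have h2 := hconst x hax (hxc.trans hce)
          have h3 : M * x ≤ M * (a + h) := by gcongr; exact hxc.trans hch
          simp only [p] at h1 ⊢
          linarith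
      have h2 := hg_mono a c hac hct
      simp only [H]
      linarith
  let S : Set ℝ := {a | a ∈ Set.Icc s t ∧ H s + M * (a - s) ≤ H a}
  have hsS : s ∈ S := ⟨⟨le_rfl, hst⟩, by simp⟩
  have hSb : BddAbove S := ⟨t, fun a ha => ha.1.2⟩
  set x := sSup S with hx
  have hsx : s ≤ x := le_csSup hSb hsS
  have hxt : x ≤ t := csSup_le ⟨s, hsS⟩ fun a ha => ha.1.2
  have hPx : H s + M * (x - s) ≤ H x := by
    have : x ≤ (H x - H s) / M + s := by
      refine csSup_le ⟨s, hsS⟩ fun a ha => ?_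
      have h1 := hH_mono a x (hs.trans ha.1.1) (le_csSup hSb ha) (hxt.trans ht)
      rw [← sub_le_iff_le_add, le_div_iff₀ hM]
      linarith [ha.2, mul_comm M (a - s)]
    rw [← sub_le_iff_le_add, le_div_iff₀ hM] at this
    linarith [mul_comm M (x - s)]
  have hxt' : x = t := by
    by_contra hne
    obtain ⟨b, hxb, hbt, hb⟩ := hstep x hsx (lt_of_le_of_ne hxt hne)
    have : b ≤ x := le_csSup hSb ⟨⟨hsx.trans hxb.le, hbt⟩, by linarith⟩
    linarith
  rw [hxt'] at hPx
  have h1 : g t ≤ F t' - M * t := hg_le _ _ ht fun b h1 h2 => hp_up _ _ _ h1 h2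
  have h2 : k t ≤ F t - M * t := hkp t t (hs.trans hst) le_rfl
  have h3 : F s - M * s ≤ g s := hpg s s le_rfl (hst.trans ht)
  have h4 : F s' - M * s ≤ k s := hle_k _ _ hs fun b h1 h2 => hp_lo _ _ _ h1 h2
  have h5 := hF ht
  have h6 := hF hs
  simp only [H] at hPx
  linarith

end MonotoneSlope

namespace Bohr

section Dilate

variable {G : Type*} [AddCommGroup G]

theorem carrier_subset_carrier {B B' : Bohr G} (hfreq : B.freq = B'.freq)
    (hr : B.radius ≤ B'.radius) : B.carrier ⊆ B'.carrier :=
  fun _ hx γ hγ => (hx γ (hfreq ▸ hγ)).trans hr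

theorem dilate_one (B : Bohr G) : B.dilate 1 = B := by
  cases B; simp [dilate]

theorem dilate_dilate (B : Bohr G) (δ ε : ℝ) : (B.dilate δ).dilate ε = B.dilate (ε * δ) := by
  simp [dilate, mul_assoc]

theorem rank_dilate (B : Bohr G) (δ : ℝ) : (B.dilate δ).rank = B.rank := rfl

theorem carrier_dilate_mono {B : Bohr G} (hr : 0 ≤ B.radius) {δ ε : ℝ} (h : δ ≤ ε) :
    (B.dilate δ).carrier ⊆ (B.dilate ε).carrier :=
  carrier_subset_carrier rfl (mul_le_mul_of_nonneg_right h hr)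

theorem zero_mem_carrier {B : Bohr G} (hr : 0 ≤ B.radius) : (0 : G) ∈ B.carrier :=
  fun γ _ => by simpa using hr

theorem rank_eq_zero_or_radius_nonneg {B : Bohr G} (hB : B.carrier.Nonempty) :
    B.rank = 0 ∨ 0 ≤ B.radius := by
  obtain ⟨x, hx⟩ := hB
  rcases B.freq.eq_empty_or_nonempty with h | ⟨γ, hγ⟩
  · exact Or.inl (by simp [rank, h])
  · exact Or.inr ((norm_nonneg _).trans (hx γ hγ))

theorem carrier_eq_univ_of_rank_eq_zero {B : Bohr G} (h : B.rank = 0) :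
    B.carrier = Set.univ := by
  have : B.freq = ∅ := Finset.card_eq_zero.1 h
  simp [carrier, this]

theorem regular_of_rank_eq_zero {B : Bohr G} (h : B.rank = 0) : B.Regular := by
  intro κ _
  rw [carrier_eq_univ_of_rank_eq_zero h,
    carrier_eq_univ_of_rank_eq_zero (B := B.dilate (1 + κ)) h]
  simp [h]

theorem regular_of_radius_eq_zero {B : Bohr G} (h : B.radius = 0) : B.Regular := by
  intro κ _
  have : B.dilate (1 + κ) = B := by
    obtain ⟨freq, radius⟩ := B
    obtain rfl : radius = 0 := h
    simp [dilate]
  rw [this]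
  have h0 : 0 ≤ 100 * (B.rank : ℝ) * |κ| * (Nat.card B.carrier : ℝ) := by positivity
  constructor <;> linarith

variable [Finite G]

theorem sub_mem_carrier_of_norm_sub_le {B : Bohr G} {x y : G}
    (h : ∀ γ ∈ B.freq, ‖γ x - γ y‖ ≤ B.radius) : x - y ∈ B.carrier := by
  intro γ hγ
  have hy : ‖γ y‖ = 1 := AddChar.norm_apply γ y
  have : γ x - γ y = -((1 : ℂ) - γ (x - y)) * γ y := by
    have : γ x = γ (x - y) * γ y := by rw [← AddChar.map_add_eq_mul, sub_add_cancel]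
    rw [this]; ring
  have h1 := h γ hγ
  rwa [this, norm_mul, norm_neg, hy, mul_one] at h1

theorem sub_mem_carrier_dilate {B : Bohr G} {δ : ℝ} {x y : G} (hx : x ∈ B.carrier)
    (hy : y ∈ (B.dilate δ).carrier) : x - y ∈ (B.dilate (1 + δ)).carrier := by
  refine sub_mem_carrier_of_norm_sub_le fun γ hγ => ?_
  have h1 := hx γ hγ
  have h2 := hy γ hγ
  calc ‖γ x - γ y‖ = ‖((1 : ℂ) - γ y) - ((1 : ℂ) - γ x)‖ := by congr 1; ring
    _ ≤ ‖(1 : ℂ) - γ y‖ + ‖(1 : ℂ) - γ x‖ := norm_sub_le _ _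
    _ ≤ δ * B.radius + B.radius := add_le_add h2 h1
    _ = (1 + δ) * B.radius := by ring

theorem floor_mem_Icc_of_abs_le {u r : ℝ} (hr : 0 < r) (hu : |u| ≤ 8 * r) :
    ⌊u / (r / 2)⌋ ∈ Finset.Icc (-16 : ℤ) 16 := by
  have h := abs_le.1 hu
  rw [Finset.mem_Icc, Int.le_floor, ← Int.lt_add_one_iff, Int.floor_lt,
    le_div_iff₀ (by positivity), div_lt_iff₀ (by positivity)]
  push_cast
  constructor <;> linarith

theorem abs_sub_le_of_floor_eq {u v r : ℝ} (hr : 0 < r)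
    (h : ⌊u / (r / 2)⌋ = ⌊v / (r / 2)⌋) : |u - v| ≤ r / 2 := by
  have h1 := Int.abs_sub_lt_one_of_floor_eq_floor h
  rw [← sub_div, abs_div, abs_of_pos (half_pos hr), div_lt_one (half_pos hr)] at h1
  exact h1.le

/-- Dilating a Bohr set of rank `d` by a factor `8` multiplies its size by at most `33 ^ (2 * d)`. -/
theorem card_dilate_eight_le {B : Bohr G} (hr : 0 < B.radius) :
    Nat.card (B.dilate 8).carrier ≤ 1089 ^ B.rank * Nat.card B.carrier := by
  cases nonempty_fintype G
  set r := B.radius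
  let I : Finset ℤ := Finset.Icc (-16) 16
  let cell : G → (∀ γ ∈ B.freq, ℤ × ℤ) := fun x γ _ =>
    (⌊((1 : ℂ) - γ x).re / (r / 2)⌋, ⌊((1 : ℂ) - γ x).im / (r / 2)⌋)
  let T := B.freq.pi fun _ => I ×ˢ I
  have hT : T.card = 1089 ^ B.rank := by
    simp [T, I, Finset.card_pi, rank]
  have hmaps : ∀ x ∈ (B.dilate 8).carrier.toFinset, cell x ∈ T := by
    intro x hx
    rw [Set.mem_toFinset] at hx
    refine Finset.mem_pi.2 fun γ hγ => Finset.mem_product.2 ⟨?_, ?_⟩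
    · exact floor_mem_Icc_of_abs_le hr ((Complex.abs_re_le_norm _).trans (hx γ hγ))
    · exact floor_mem_Icc_of_abs_le hr ((Complex.abs_im_le_norm _).trans (hx γ hγ))
  have hfib : ∀ c ∈ T, ((B.dilate 8).carrier.toFinset.filter fun x => cell x = c).card ≤
      B.carrier.toFinset.card := by
    intro c _
    rcases ((B.dilate 8).carrier.toFinset.filter fun x => cell x = c).eq_empty_or_nonempty with
      h | ⟨y, hy⟩
    · simp [h]
    · refine Finset.card_le_card_of_injOn (fun x => x - y) ?_ fun a _ b _ hab => sub_left_inj.1 hab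
      intro x hx
      have hxy : cell x = cell y :=
        (Finset.mem_filter.1 hx).2.trans (Finset.mem_filter.1 hy).2.symm
      rw [Set.coe_toFinset]
      refine sub_mem_carrier_of_norm_sub_le fun γ hγ => ?_
      have hc := congrFun (congrFun hxy γ) hγ
      have hre := abs_sub_le_of_floor_eq hr (Prod.ext_iff.1 hc).1
      have him := abs_sub_le_of_floor_eq hr (Prod.ext_iff.1 hc).2
      calc ‖γ x - γ y‖ ≤ |(γ x - γ y).re| + |(γ x - γ y).im| :=
            Complex.norm_le_abs_re_add_abs_im _
        _ = |((1 : ℂ) - γ x).re - ((1 : ℂ) - γ y).re| +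
            |((1 : ℂ) - γ x).im - ((1 : ℂ) - γ y).im| := by
          congr 1
          · rw [← abs_neg]; congr 1; simp
          · rw [← abs_neg]; congr 1; simp; ring
        _ ≤ r := by linarith
  have := Finset.card_le_mul_card_image_of_maps_to hmaps _ hfib
  rw [hT] at this
  simp only [Nat.card_eq_fintype_card, ← Set.toFinset_card]
  linarith

theorem exists_card_dilate_add_eq {B : Bohr G} (hr : 0 ≤ B.radius) (a : ℝ) :
    ∃ e > 0, Nat.card (B.dilate (a + e)).carrier = Nat.card (B.dilate a).carrier := by
  have hev : ∀ x : G, ∀ᶠ e in nhdsWithin (0 : ℝ) (Set.Ioi 0),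
      x ∈ (B.dilate (a + e)).carrier → x ∈ (B.dilate a).carrier := by
    intro x
    by_cases hx : x ∈ (B.dilate a).carrier
    · exact Filter.Eventually.of_forall fun _ _ => hx
    · obtain ⟨γ, hγ, hlt⟩ : ∃ γ ∈ B.freq, a * B.radius < ‖(1 : ℂ) - γ x‖ := by
        by_contra! h
        exact hx h
      have hcont : Filter.Tendsto (fun e : ℝ => (a + e) * B.radius) (nhdsWithin 0 (Set.Ioi 0))
          (nhds (a * B.radius)) := by
        have : Continuous fun e : ℝ => (a + e) * B.radius := by fun_prop
        simpa using (this.tendsto 0).mono_left nhdsWithin_le_nhds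
      filter_upwards [hcont.eventually_lt_const hlt] with e he hxe
      exact absurd (hxe γ hγ) (not_le.2 he)
  obtain ⟨e, he, hpos⟩ := ((Filter.eventually_all.2 hev).and self_mem_nhdsWithin).exists
  refine ⟨e, hpos, ?_⟩
  rw [(carrier_dilate_mono hr (le_add_of_nonneg_right (le_of_lt hpos))).antisymm he]

theorem card_carrier_pos {B : Bohr G} (hr : 0 ≤ B.radius) : 0 < Nat.card B.carrier :=
  have : Nonempty B.carrier := ⟨⟨0, zero_mem_carrier hr⟩⟩
  Nat.card_pos

theorem log_card_dilate_eight_le {B : Bohr G} (hr : 0 < B.radius) :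
    Real.log (Nat.card (B.dilate 8).carrier) ≤
      8 * B.rank + Real.log (Nat.card B.carrier) := by
  have hpos : (0 : ℝ) < Nat.card B.carrier := by exact_mod_cast card_carrier_pos hr.le
  have hpos8 : (0 : ℝ) < Nat.card (B.dilate 8).carrier := by
    exact_mod_cast card_carrier_pos (B := B.dilate 8) (by simp only [dilate]; positivity)
  have h : (Nat.card (B.dilate 8).carrier : ℝ) ≤ 1089 ^ B.rank * Nat.card B.carrier := by
    exact_mod_cast card_dilate_eight_le hr
  have hlog : Real.log 1089 ≤ 8 := by
    have h1 : Real.log 1089 ≤ Real.log (2 ^ 11) := Real.log_le_log (by norm_num) (by norm_num)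
    rw [Real.log_pow] at h1
    have := Real.log_two_lt_d9
    push_cast at h1
    linarith
  calc _ ≤ Real.log (1089 ^ B.rank * Nat.card B.carrier) := Real.log_le_log hpos8 h
    _ = B.rank * Real.log 1089 + Real.log (Nat.card B.carrier) := by
      rw [Real.log_mul (by positivity) hpos.ne', Real.log_pow]
    _ ≤ _ := by
      have : (B.rank : ℝ) * Real.log 1089 ≤ B.rank * 8 := by gcongr
      linarith

theorem le_one_add_two_mul_and_one_sub_mul_le {m n u : ℝ} (hm : 0 < m) (hn : 0 < n) (hu : 0 ≤ u)
    (hu' : u ≤ 1 / 2) (h : |Real.log n - Real.log m| ≤ u) :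
    (1 - 2 * u) * m ≤ n ∧ n ≤ (1 + 2 * u) * m := by
  obtain ⟨h1, h2⟩ := abs_le.1 h
  have hlo : m * (1 - u) ≤ n := by
    calc m * (1 - u) ≤ m * Real.exp (-u) := by
          gcongr; linarith [Real.add_one_le_exp (-u)]
      _ = Real.exp (Real.log m - u) := by rw [sub_eq_add_neg, Real.exp_add, Real.exp_log hm]
      _ ≤ Real.exp (Real.log n) := Real.exp_le_exp.2 (by linarith)
      _ = n := Real.exp_log hn
  have hhi : n * (1 - u) ≤ m := by
    calc n * (1 - u) ≤ n * Real.exp (-u) := by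
          gcongr; linarith [Real.add_one_le_exp (-u)]
      _ = Real.exp (Real.log n - u) := by rw [sub_eq_add_neg, Real.exp_add, Real.exp_log hn]
      _ ≤ Real.exp (Real.log m) := Real.exp_le_exp.2 (by linarith)
      _ = m := Real.exp_log hm
  constructor
  · nlinarith
  · have : 1 ≤ (1 + 2 * u) * (1 - u) := by nlinarith
    nlinarith [mul_le_mul_of_nonneg_left this hn.le,
      mul_le_mul_of_nonneg_left hhi (by linarith : 0 ≤ 1 + 2 * u)]

/-- Every nonempty Bohr set has regular dilates at every scale. -/
theorem exists_subR {B : Bohr G} (hB : B.carrier.Nonempty) {r : ℝ} (hr : 0 ≤ r) :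
    ∃ B', subR r B' B := by
  rcases B.rank.eq_zero_or_pos with hd | hd
  · exact ⟨_, r, by linarith, le_rfl, rfl, regular_of_rank_eq_zero hd⟩
  rcases ((rank_eq_zero_or_radius_nonneg hB).resolve_left hd.ne').eq_or_lt' with hR | hR
  · exact ⟨_, r, by linarith, le_rfl, rfl, regular_of_radius_eq_zero (by simp [dilate, hR])⟩
  rcases hr.eq_or_lt' with rfl | hr
  · exact ⟨_, 0, by simp, le_rfl, rfl, regular_of_radius_eq_zero (by simp [dilate])⟩
  have hd1 : (1 : ℝ) ≤ B.rank := by exact_mod_cast hd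
  have hcard : ∀ {δ : ℝ}, 0 ≤ δ → (0 : ℝ) < Nat.card (B.dilate δ).carrier := fun hδ => by
    exact_mod_cast card_carrier_pos (B := B.dilate _) (mul_nonneg hδ hR.le)
  let F : ℝ → ℝ := fun δ => Real.log (Nat.card (B.dilate δ).carrier)
  have hF : Monotone F := by
    intro δ ε h
    have hle : Nat.card (B.dilate δ).carrier ≤ Nat.card (B.dilate ε).carrier :=
      Nat.card_mono (Set.toFinite _) (carrier_dilate_mono hR.le h)
    rcases (Nat.card (B.dilate δ).carrier).eq_zero_or_pos with h0 | h0
    · simp only [F, h0, Nat.cast_zero, Real.log_zero]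
      exact Real.log_natCast_nonneg _
    · exact Real.log_le_log (by exact_mod_cast h0) (by exact_mod_cast hle)
  have hright : ∀ a, ∃ e > 0, F (a + e) = F a := by
    intro a
    obtain ⟨e, he, h⟩ := exists_card_dilate_add_eq hR.le a
    exact ⟨e, he, by simp only [F, h]⟩
  have hgrow : F (2 * r) ≤ 8 * B.rank + F (r / 4) := by
    have h := log_card_dilate_eight_le (B := B.dilate (r / 4)) (by simp only [dilate]; positivity)
    rwa [dilate_dilate, show 8 * (r / 4) = 2 * r by ring] at h
  obtain ⟨a, ⟨ha1, ha2⟩, ha⟩ := exists_forall_abs_sub_le_mul hF hright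
    (s' := r / 4) (s := r / 2) (t := r) (t' := 2 * r) (M := 50 * B.rank / r)
    (by linarith) (by linarith) (by linarith) (by positivity) (by
      have : 50 * (B.rank : ℝ) / r * (r - r / 2) = 25 * B.rank := by field_simp; ring
      rw [this]; linarith)
  have ha0 : 0 < a := by linarith
  refine ⟨_, a, ha1, ha2, rfl, fun κ hκ => ?_⟩
  rw [rank_dilate] at hκ ⊢
  rw [dilate_dilate]
  have hdκ : 100 * B.rank * |κ| ≤ 1 := by
    rwa [le_div_iff₀ (by positivity), mul_comm] at hκ
  have hκ' : |κ| ≤ 1 / 100 := by nlinarith [abs_nonneg κ]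
  obtain ⟨hκ1, hκ2⟩ := abs_le.1 hκ'
  have hb := ha ((1 + κ) * a) ⟨by nlinarith, by nlinarith⟩
  have hu : 50 * B.rank / r * |(1 + κ) * a - a| ≤ 50 * B.rank * |κ| := by
    rw [show (1 + κ) * a - a = κ * a by ring, abs_mul, abs_of_pos ha0, div_mul_eq_mul_div,
      div_le_iff₀ hr]
    have : 50 * (B.rank : ℝ) * |κ| * a ≤ 50 * B.rank * |κ| * r := by gcongr
    linarith
  have := le_one_add_two_mul_and_one_sub_mul_le (hcard ha0.le)
    (hcard (mul_nonneg (by linarith : 0 ≤ 1 + κ) ha0.le)) (by positivity) (by linarith)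
    (hb.trans hu)
  rwa [show 2 * (50 * B.rank * |κ|) = 100 * B.rank * |κ| by ring] at this

end Dilate

end Bohr

section Averaging

theorem indic_nonneg {X : Type*} (S : Set X) (x : X) : 0 ≤ indic S x := by
  unfold indic; split_ifs <;> norm_num

theorem sum_indic {X : Type*} [Fintype X] (S : Set X) : ∑ x, indic S x = Nat.card S := by
  simp [indic]

theorem sum_indic_sub_left (S : Set G) (b : G) : ∑ v, indic S (b - v) = Nat.card S := by
  rw [← sum_indic S]
  exact Equiv.sum_comp (Equiv.subLeft b) (indic S)

theorem mu_eq_indic {X : Type*} [Fintype X] (S : Set X) (x : X) :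
    mu S x = (Fintype.card X : ℝ) / Nat.card S * indic S x := by
  simp [mu, indic]

theorem mu_nonneg {X : Type*} [Fintype X] (S : Set X) (x : X) : 0 ≤ mu S x := by
  rw [mu_eq_indic]
  exact mul_nonneg (by positivity) (indic_nonneg S x)

theorem dcv_mu_mu_le (A : Set G) (x : G) :
    dcv (mu A) (mu A) x ≤ (Fintype.card G : ℝ) / Nat.card A := by
  have hG : (0 : ℝ) < Fintype.card G := by exact_mod_cast Fintype.card_pos
  rcases (Nat.card A).eq_zero_or_pos with h | h
  · have h0 : ∀ y, mu A y = 0 := fun y => by simp only [mu, h, Nat.cast_zero, div_zero, ite_self]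
    simp only [dcv, ex, h0, h, Nat.cast_zero, div_zero, mul_zero, Finset.sum_const_zero, zero_div,
      le_refl]
  have hA : (0 : ℝ) < Nat.card A := by exact_mod_cast h
  have hle : ∀ y, mu A y ≤ (Fintype.card G : ℝ) / Nat.card A := fun y => by
    unfold mu; split_ifs
    · exact le_rfl
    · positivity
  have hsum : ∑ y, mu A y = Fintype.card G := by
    simp_rw [mu_eq_indic, ← Finset.mul_sum, sum_indic]
    field_simp
  rw [dcv, ex, div_le_iff₀ hG]
  calc ∑ y, mu A y * mu A (x + y) ≤ ∑ y, mu A y * ((Fintype.card G : ℝ) / Nat.card A) :=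
        Finset.sum_le_sum fun y _ => mul_le_mul_of_nonneg_left (hle _) (mu_nonneg A y)
    _ = _ := by rw [← Finset.sum_mul, hsum, mul_comm]

/-- The sum of `f (b - a)` over `a ∈ X` and `b ∈ Y`. -/
noncomputable def pairSum (f : G → ℝ) (X Y : Set G) : ℝ :=
  ∑ a, ∑ b, indic X a * indic Y b * f (b - a)

theorem ip_dcv_mu_mu (f : G → ℝ) (X Y : Set G) :
    ip f (dcv (mu X) (mu Y)) = pairSum f X Y / (Nat.card X * Nat.card Y) := by
  have hG : (Fintype.card G : ℝ) ≠ 0 := by exact_mod_cast Fintype.card_ne_zero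
  have h : ∑ x, f x * (∑ y, mu X y * mu Y (x + y)) =
      (Fintype.card G : ℝ) ^ 2 / (Nat.card X * Nat.card Y) * pairSum f X Y := by
    simp_rw [Finset.mul_sum]
    rw [Finset.sum_comm, pairSum, Finset.mul_sum]
    refine Finset.sum_congr rfl fun y _ => ?_
    rw [Finset.mul_sum, ← Equiv.sum_comp (Equiv.addRight y) (fun b => (Fintype.card G : ℝ) ^ 2 /
      (Nat.card X * Nat.card Y) * (indic X y * indic Y b * f (b - y)))]
    refine Finset.sum_congr rfl fun x _ => ?_
    simp only [mu_eq_indic, Equiv.coe_addRight, add_sub_cancel_right]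
    ring
  simp only [ip, dcv, ex]
  simp_rw [← mul_div_assoc, ← Finset.sum_div]
  rw [h]
  field_simp

theorem indic_inter_translate {H : Type*} [AddCommGroup H] (Y D : Set H) (v b : H) :
    indic (Y ∩ (fun b => b + v) '' D) b = indic Y b * indic D (b - v) := by
  have : b ∈ (fun b => b + v) '' D ↔ b - v ∈ D := by
    simp [← sub_eq_add_neg]
  simp only [indic, Set.mem_inter_iff, this]
  split_ifs <;> simp_all

theorem sum_card_inter_translate (Y D : Set G) :
    ∑ v, (Nat.card ↥(Y ∩ (fun b => b + v) '' D) : ℝ) = Nat.card D * Nat.card Y := by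
  simp_rw [← sum_indic, indic_inter_translate]
  rw [Finset.sum_comm]
  simp_rw [← Finset.mul_sum, sum_indic_sub_left, sum_indic, ← Finset.sum_mul, mul_comm]
  rw [sum_indic]

theorem sum_pairSum_inter_translate (f : G → ℝ) (X Y D : Set G) :
    ∑ v, pairSum f X (Y ∩ (fun b => b + v) '' D) = Nat.card D * pairSum f X Y := by
  simp_rw [pairSum, indic_inter_translate]
  rw [Finset.sum_comm, Finset.mul_sum]
  refine Finset.sum_congr rfl fun a _ => ?_
  rw [Finset.sum_comm, Finset.mul_sum]
  refine Finset.sum_congr rfl fun b _ => ?_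
  rw [← sum_indic_sub_left D b, Finset.sum_mul]
  exact Finset.sum_congr rfl fun v _ => by ring

theorem pairSum_le {f : G → ℝ} {K : ℝ} (hf : ∀ x, f x ≤ K) (X Y : Set G) :
    pairSum f X Y ≤ K * Nat.card X * Nat.card Y := by
  rw [← sum_indic X, ← sum_indic Y, mul_assoc, Finset.sum_mul_sum, Finset.mul_sum]
  refine Finset.sum_le_sum fun a _ => ?_
  rw [Finset.mul_sum]
  refine Finset.sum_le_sum fun b _ => ?_
  rw [mul_comm K]
  exact mul_le_mul_of_nonneg_left (hf _) (mul_nonneg (indic_nonneg _ _) (indic_nonneg _ _))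

/-- If `f` is large on average over `X × Y`, then it is large on average over `X × (Y ∩ (D + v))`
for some translate `D + v` of `D` in which `Y` is dense. -/
theorem exists_translate_pairSum_ge {f : G → ℝ} {K σ τ : ℝ} {X Y D T : Set G}
    (hf : ∀ x, f x ≤ K) (hK : 0 ≤ K) (hσ : 0 ≤ σ) (hτ : 0 ≤ τ) (hD : D.Nonempty)
    (hT : ∀ y ∈ Y, ∀ x ∈ D, y - x ∈ T)
    (h : σ * Nat.card X * Nat.card Y + K * Nat.card X * τ * Nat.card T < pairSum f X Y) :
    ∃ v, (Y ∩ (fun b => b + v) '' D).Nonempty ∧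
      τ * Nat.card D ≤ Nat.card ↥(Y ∩ (fun b => b + v) '' D) ∧
      σ * Nat.card X * Nat.card ↥(Y ∩ (fun b => b + v) '' D) ≤
        pairSum f X (Y ∩ (fun b => b + v) '' D) := by
  by_contra! hcon
  have hD0 : (0 : ℝ) < Nat.card D := by
    have := hD.to_subtype
    exact_mod_cast Nat.card_pos
  have key : ∀ v, pairSum f X (Y ∩ (fun b => b + v) '' D) ≤
      σ * Nat.card X * Nat.card ↥(Y ∩ (fun b => b + v) '' D) +
        K * Nat.card X * τ * Nat.card D * indic T v := by
    intro v
    have hnn : 0 ≤ K * Nat.card X * τ * Nat.card D * indic T v :=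
      mul_nonneg (by positivity) (indic_nonneg _ _)
    have hle := pairSum_le hf X (Y ∩ (fun b => b + v) '' D)
    rcases (Y ∩ (fun b => b + v) '' D).eq_empty_or_nonempty with h0 | h0
    · rw [h0] at hle ⊢
      simp only [Nat.card_of_isEmpty, Nat.cast_zero, mul_zero, zero_add] at hle ⊢
      exact hle.trans hnn
    by_cases hdense : τ * Nat.card D ≤ Nat.card ↥(Y ∩ (fun b => b + v) '' D)
    · linarith [hcon v h0 hdense]
    have hvT : indic T v = 1 := by
      obtain ⟨y, hy, x, hx, hxy⟩ := h0
      have := hT y hy x hx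
      have hv : y - x = v := by rw [← hxy]; simp
      rw [hv] at this
      simp [indic, this]
    have h1 : K * Nat.card X * Nat.card ↥(Y ∩ (fun b => b + v) '' D) ≤
        K * Nat.card X * (τ * Nat.card D) := by
      gcongr
      exact (not_le.1 hdense).le
    have h2 : 0 ≤ σ * Nat.card X * Nat.card ↥(Y ∩ (fun b => b + v) '' D) := by positivity
    rw [hvT]
    linarith
  have hsum := Finset.sum_le_sum fun v (_ : v ∈ Finset.univ) => key v
  rw [sum_pairSum_inter_translate, Finset.sum_add_distrib, ← Finset.mul_sum, ← Finset.mul_sum,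
    sum_card_inter_translate, sum_indic] at hsum
  have := mul_lt_mul_of_pos_left h hD0
  linarith

end Averaging

/-- From a lower bound on `⟨μ_A∘μ_A, μ_{C₀}∘μ_{C₀}⟩` one finds
`A₁ ⊆ B'`, `A₂ ⊆ B'' + t`, localized to nested regular Bohr sets, with
`⟨μ_A∘μ_A, μ_{A₁}∘μ_{A₂}⟩ ≥ σ`. -/
theorem statement11 :
    ∃ c C : ℝ, 0 < c ∧
    ∀ (N : ℕ) [NeZero N], Odd N →
    ∀ (B B₁ : Bohr (ZMod N)) (d : ℕ),
      B.Regular → B₁.Regular → B₁.rank = d →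
    ∀ A : Set (ZMod N), A ⊆ B.carrier →
    ∀ α : ℝ, α = relDensity A B.carrier → 0 < α →
    ∀ C₀ : Set (ZMod N), C₀ ⊆ B₁.carrier →
    ∀ γ : ℝ, γ = relDensity C₀ B₁.carrier → 0 < γ →
    ∀ σ : ℝ, B.dens⁻¹ ≤ σ →
      (2 : ℝ) ^ 7 * σ ≤ ip (dcv (mu A) (mu A)) (dcv (mu C₀) (mu C₀)) →
      ∃ B' B'' : Bohr (ZMod N),
        (∃ ρ : ℝ, (c / (2 * d)) ^ 2 ≤ ρ ∧ B' = B₁.dilate ρ ∧ B'.Regular) ∧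
        Bohr.subR (c / d) B'' B' ∧
      ∃ t : ZMod N, ∃ A₁ A₂ : Set (ZMod N), A₁.Nonempty ∧ A₂.Nonempty ∧
        A₁ ⊆ B'.carrier ∧ A₂ ⊆ (fun b => b + t) '' B''.carrier ∧
        min (α ^ C * γ) (α ^ (Lq α / Real.log 2 + C)) ≤ relDensity A₁ B'.carrier ∧
        min (α ^ C * γ) (α ^ (Lq α / Real.log 2 + C)) ≤
          relDensity A₂ ((fun b => b + t) '' B''.carrier) ∧
        σ ≤ ip (dcv (mu A) (mu A)) (dcv (mu A₁) (mu A₂)) := by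
  refine ⟨1 / 100, 2, by norm_num, ?_⟩
  intro N _ _ B B₁ d hB hB₁ hd A hAB α hα hα0 C₀ hC γ hγ hγ0 σ hσ hip
  have hcard_pos : ∀ {S : Set (ZMod N)}, S.Nonempty → (0 : ℝ) < Nat.card S := fun hS => by
    have := hS.to_subtype
    exact_mod_cast Nat.card_pos
  have hnonempty : ∀ {S T : Set (ZMod N)}, 0 < relDensity S T → S.Nonempty := by
    intro S T h
    by_contra hS
    rw [Set.not_nonempty_iff_eq_empty.1 hS] at h
    simp [relDensity] at h
  have hA := hnonempty (hα ▸ hα0)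
  have hC₀ := hnonempty (hγ ▸ hγ0)
  have ha := hcard_pos hA
  have hb := hcard_pos (hA.mono hAB)
  have hc := hcard_pos hC₀
  have hb₁ := hcard_pos (hC₀.mono hC)
  have hα1 : α ≤ 1 := by
    rw [hα, relDensity, div_le_one hb]
    exact_mod_cast Nat.card_mono (Set.toFinite _) hAB
  have hG : (0 : ℝ) < Fintype.card (ZMod N) := by exact_mod_cast Fintype.card_pos
  obtain ⟨B'', δ, hδ1, hδ2, rfl, hreg⟩ :=
    Bohr.exists_subR (hC₀.mono hC) (r := 1 / 100 / d) (by positivity)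
  have hδ0 : 0 ≤ δ := le_trans (by positivity) hδ1
  have hD : (B₁.dilate δ).carrier.Nonempty := by
    rcases Bohr.rank_eq_zero_or_radius_nonneg (hC₀.mono hC) with h | h
    · exact Bohr.carrier_eq_univ_of_rank_eq_zero (B := B₁.dilate δ) h ▸ Set.univ_nonempty
    · exact ⟨0, Bohr.zero_mem_carrier (mul_nonneg hδ0 h)⟩
  have hT : (Nat.card (B₁.dilate (1 + δ)).carrier : ℝ) ≤ 2 * Nat.card B₁.carrier := by
    have hδd : |δ| ≤ 1 / (100 * B₁.rank) := by
      rwa [abs_of_nonneg hδ0, hd, ← div_div]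
    refine (hB₁ δ hδd).2.trans ?_
    gcongr
    have : 100 * B₁.rank * |δ| ≤ 100 * B₁.rank * (1 / (100 * B₁.rank)) := by gcongr
    rw [mul_one_div] at this
    linarith [div_self_le_one (100 * (B₁.rank : ℝ))]
  have hσ0 : 0 < σ := by
    refine lt_of_lt_of_le (inv_pos.2 ?_) hσ
    rw [Bohr.dens, Nat.card_eq_fintype_card (α := ZMod N)]
    positivity
  have hf : ∀ x, dcv (mu A) (mu A) x ≤ σ / α := by
    refine fun x => (dcv_mu_mu_le A x).trans ?_
    rw [le_div_iff₀ hα0]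
    refine le_trans (le_of_eq ?_) hσ
    rw [hα, relDensity, Bohr.dens, Nat.card_eq_fintype_card (α := ZMod N)]
    field_simp
  rw [ip_dcv_mu_mu, le_div_iff₀ (by positivity)] at hip
  obtain ⟨v, hne, hdense, hlarge⟩ := exists_translate_pairSum_ge (X := C₀) (Y := C₀)
    (D := (B₁.dilate δ).carrier) (T := (B₁.dilate (1 + δ)).carrier) (σ := σ) (τ := α ^ 2 * γ)
    hf (by positivity) hσ0.le (by positivity) hD
    (fun y hy x hx => Bohr.sub_mem_carrier_dilate (hC hy) hx) (by
      have h1 : σ / α * Nat.card C₀ * (α ^ 2 * γ) * Nat.card (B₁.dilate (1 + δ)).carrier ≤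
          σ / α * Nat.card C₀ * (α ^ 2 * γ) * (2 * Nat.card B₁.carrier) := by gcongr
      have h2 : σ / α * Nat.card C₀ * (α ^ 2 * γ) * (2 * Nat.card B₁.carrier) =
          2 * α * (σ * (Nat.card C₀ * Nat.card C₀)) := by
        rw [hγ, relDensity]; field_simp
      have h3 : 2 * α * (σ * (Nat.card C₀ * Nat.card C₀)) ≤
          2 * 1 * (σ * (Nat.card C₀ * Nat.card C₀)) := by gcongr
      have h4 : 0 < σ * (Nat.card C₀ * Nat.card C₀) := by positivity
      linarith)
  have hpow : α ^ (2 : ℝ) = α ^ 2 := Real.rpow_two α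
  refine ⟨B₁, B₁.dilate δ, ⟨1, ?_, B₁.dilate_one.symm, hB₁⟩, ⟨δ, hδ1, hδ2, rfl, hreg⟩,
    v, C₀, _, hC₀, hne, hC, Set.inter_subset_right, (min_le_left _ _).trans ?_,
    (min_le_left _ _).trans ?_, ?_⟩
  · refine pow_le_one₀ (by positivity) ?_
    rcases d.eq_zero_or_pos with h | h
    · simp [h]
    · have : (1 : ℝ) ≤ d := by exact_mod_cast h
      rw [div_le_one (by positivity)]
      linarith
  · rw [hpow, ← hγ]
    exact mul_le_of_le_one_left hγ0.le (pow_le_one₀ hα0.le hα1)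
  · rwa [hpow, relDensity, Nat.card_image_of_injective (add_left_injective v),
      le_div_iff₀ (hcard_pos hD)]
  · have := hcard_pos hne
    rwa [ip_dcv_mu_mu, le_div_iff₀ (by positivity), ← mul_assoc]

end Formal
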